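/- One has ∫₀¹ ∫₀^t ( t(1−t) + s(t−s) )^{−3/2} ds dt ≥ (6/5) · ∫₀¹ ∫₀^t ( t(1−s) )^{−3/2} ds dt, where both double integrals over the triangle {(s,t) : 0 ≤ s ≤ t ≤ 1} are finite. -/

import Mathlib

open MeasureTheory

/-- Tonelli and Fubini over the triangle `0 ≤ s ≤ t ≤ 1`, integrating first in `s`. -/
theorem integrableOn_triangle_and_integral_eq {f : ℝ × ℝ → ℝ} {g : ℝ → ℝ}
    (hf : Measurable f)
    (hf_nonneg : ∀ p : ℝ × ℝ, 0 ≤ p.1 → p.1 ≤ p.2 → p.2 ≤ 1 → 0 ≤ f p)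
    (hf_int : ∀ t ∈ Set.Ioo (0 : ℝ) 1, IntervalIntegrable (fun s => f (s, t)) volume 0 t)
    (hfg : ∀ t ∈ Set.Ioo (0 : ℝ) 1, ∫ s in (0 : ℝ)..t, f (s, t) = g t)
    (hg : IntervalIntegrable g volume 0 1) :
    IntegrableOn f {p : ℝ × ℝ | 0 ≤ p.1 ∧ p.1 ≤ p.2 ∧ p.2 ≤ 1} volume ∧
      ∫ p in {p : ℝ × ℝ | 0 ≤ p.1 ∧ p.1 ≤ p.2 ∧ p.2 ≤ 1}, f p = ∫ t in (0 : ℝ)..1, g t := by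
  set S : Set (ℝ × ℝ) := {p | 0 ≤ p.1 ∧ p.1 ≤ p.2 ∧ p.2 ≤ 1} with hS
  have hS_meas : MeasurableSet S :=
    (measurableSet_le measurable_const measurable_fst).inter
      ((measurableSet_le measurable_fst measurable_snd).inter
        (measurableSet_le measurable_snd measurable_const))
  have hF_nonneg : ∀ p, 0 ≤ S.indicator f p :=
    Set.indicator_nonneg fun p hp => hf_nonneg p hp.1 hp.2.1 hp.2.2
  have section_in : ∀ t ∈ Set.Ioo (0 : ℝ) 1,
      (fun s => S.indicator f (s, t)) = (Set.Icc 0 t).indicator fun s => f (s, t) := by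
    intro t ht
    funext s
    simp only [Set.indicator_apply, hS, Set.mem_ofPred_eq, Set.mem_Icc, ht.2.le, and_true]
  have section_out : ∀ t ∉ Set.Icc (0 : ℝ) 1, (fun s => S.indicator f (s, t)) = 0 := by
    intro t ht
    funext s
    refine Set.indicator_of_notMem (fun h => ht ?_) f
    exact ⟨h.1.trans h.2.1, h.2.2⟩
  have ae_cases : ∀ᵐ t : ℝ, t ∈ Set.Ioo (0 : ℝ) 1 ∨ t ∉ Set.Icc (0 : ℝ) 1 := by
    filter_upwards [Measure.ae_ne volume (0 : ℝ), Measure.ae_ne volume (1 : ℝ)] with t h0 h1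
    by_cases h : t ∈ Set.Icc (0 : ℝ) 1
    · exact Or.inl ⟨lt_of_le_of_ne h.1 h0.symm, lt_of_le_of_ne h.2 h1⟩
    · exact Or.inr h
  have section_integrable : ∀ᵐ t : ℝ, Integrable fun s => S.indicator f (s, t) := by
    filter_upwards [ae_cases] with t ht
    rcases ht with ht | ht
    · rw [section_in t ht, integrable_indicator_iff measurableSet_Icc,
        integrableOn_Icc_iff_integrableOn_Ioc]
      exact (intervalIntegrable_iff_integrableOn_Ioc_of_le ht.1.le).1 (hf_int t ht)
    · rw [section_out t ht]
      exact integrable_zero _ _ _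
  have section_integral :
      (fun t => ∫ s, S.indicator f (s, t)) =ᵐ[volume] (Set.Ioc 0 1).indicator g := by
    filter_upwards [ae_cases] with t ht
    rcases ht with ht | ht
    · rw [section_in t ht, integral_indicator measurableSet_Icc, integral_Icc_eq_integral_Ioc,
        ← intervalIntegral.integral_of_le ht.1.le, hfg t ht,
        Set.indicator_of_mem (Set.Ioo_subset_Ioc_self ht)]
    · rw [section_out t ht, Set.indicator_of_notMem fun h => ht (Set.Ioc_subset_Icc_self h)]
      simp
  have hF : Integrable (S.indicator f) ((volume : Measure ℝ).prod volume) := by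
    rw [integrable_prod_iff' (hf.indicator hS_meas).aestronglyMeasurable]
    refine ⟨section_integrable, ?_⟩
    simp only [Real.norm_of_nonneg (hF_nonneg _)]
    refine Integrable.congr ?_ section_integral.symm
    rw [integrable_indicator_iff measurableSet_Ioc]
    exact (intervalIntegrable_iff_integrableOn_Ioc_of_le zero_le_one).1 hg
  refine ⟨(integrable_indicator_iff hS_meas).1 hF, ?_⟩
  rw [← integral_indicator hS_meas, Measure.volume_eq_prod, integral_prod_symm _ hF,
    integral_congr_ae section_integral, integral_indicator measurableSet_Ioc,
    intervalIntegral.integral_of_le zero_le_one]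

/-- The fundamental theorem of calculus for a nonnegative derivative that may blow up at the
endpoints of the interval. -/
theorem intervalIntegrable_and_integral_eq_sub_of_nonneg {G g : ℝ → ℝ} {a b : ℝ} (hab : a ≤ b)
    (hG : ContinuousOn G (Set.Icc a b))
    (hderiv : ∀ t ∈ Set.Ioo a b, HasDerivAt G (g t) t) (hg : ∀ t ∈ Set.Ioo a b, 0 ≤ g t) :
    IntervalIntegrable g volume a b ∧ ∫ t in a..b, g t = G b - G a := by
  have hint : IntervalIntegrable g volume a b :=
    (intervalIntegrable_iff_integrableOn_Ioc_of_le hab).2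
      (intervalIntegral.integrableOn_deriv_of_nonneg hG hderiv hg)
  exact ⟨hint, intervalIntegral.integral_eq_sub_of_hasDerivAt_of_le hab hG hderiv hint⟩

theorem Real.rpow_neg_three_halves {x : ℝ} (hx : 0 < x) :
    x ^ (-(3 : ℝ) / 2) = (x * √x)⁻¹ := by
  rw [show -(3 : ℝ) / 2 = -(1 + 1 / 2) by norm_num, Real.rpow_neg hx.le, Real.rpow_add hx,
    Real.rpow_one, Real.sqrt_eq_rpow]

theorem inner_integral_symmetric {t : ℝ} (ht : t ∈ Set.Ioo (0 : ℝ) 1) :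
    IntervalIntegrable (fun s => (t * (1 - t) + s * (t - s)) ^ (-(3 : ℝ) / 2)) volume 0 t ∧
      ∫ s in (0 : ℝ)..t, (t * (1 - t) + s * (t - s)) ^ (-(3 : ℝ) / 2) =
        4 / ((4 - 3 * t) * √(t * (1 - t))) := by
  obtain ⟨h0, h1⟩ := ht
  have hA : 0 < 4 - 3 * t := by linarith
  have hA_ne : 4 - t * 3 ≠ 0 := by rw [mul_comm]; exact hA.ne'
  have hpos : ∀ s ∈ Set.Icc 0 t, 0 < t * (1 - t) + s * (t - s) := fun s hs =>
    add_pos_of_pos_of_nonneg (mul_pos h0 (sub_pos.2 h1)) (mul_nonneg hs.1 (sub_nonneg.2 hs.2))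
  have hderiv : ∀ s ∈ Set.Icc 0 t,
      HasDerivAt (fun s => (4 * s - 2 * t) / (t * (4 - 3 * t)) / √(t * (1 - t) + s * (t - s)))
        ((t * (1 - t) + s * (t - s)) ^ (-(3 : ℝ) / 2)) s := by
    intro s hs
    have hΔ := hpos s hs
    have hq : HasDerivAt (fun s => t * (1 - t) + s * (t - s)) (t - 2 * s) s := by
      refine (((hasDerivAt_id s).mul ((hasDerivAt_id s).const_sub t)).const_add
        (t * (1 - t))).congr_deriv ?_
      simp only [id]; ring
    have hl : HasDerivAt (fun s => (4 * s - 2 * t) / (t * (4 - 3 * t)))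
        (4 / (t * (4 - 3 * t))) s := by
      refine ((((hasDerivAt_id s).const_mul 4).sub_const (2 * t)).div_const _).congr_deriv ?_
      simp
    refine (hl.div (hq.sqrt hΔ.ne') (Real.sqrt_ne_zero'.2 hΔ)).congr_deriv ?_
    rw [Real.rpow_neg_three_halves hΔ]
    have hr := Real.sqrt_pos.2 hΔ
    have hr2 := Real.sq_sqrt hΔ.le
    set r := √(t * (1 - t) + s * (t - s))
    rw [← hr2]
    field_simp
    rw [hr2]
    ring
  obtain ⟨hint, heq⟩ := intervalIntegrable_and_integral_eq_sub_of_nonneg h0.le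
    (fun s hs => (hderiv s hs).continuousAt.continuousWithinAt)
    (fun s hs => hderiv s (Set.Ioo_subset_Icc_self hs))
    (fun s hs => Real.rpow_nonneg (hpos s (Set.Ioo_subset_Icc_self hs)).le _)
  refine ⟨hint, heq.trans ?_⟩
  have hr : 0 < √(t * (1 - t)) := Real.sqrt_pos.2 (mul_pos h0 (sub_pos.2 h1))
  simp only [sub_self, mul_zero, zero_mul, add_zero]
  field_simp
  ring

theorem inner_integral_product {t : ℝ} (ht : t ∈ Set.Ioo (0 : ℝ) 1) :
    IntervalIntegrable (fun s => (t * (1 - s)) ^ (-(3 : ℝ) / 2)) volume 0 t ∧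
      ∫ s in (0 : ℝ)..t, (t * (1 - s)) ^ (-(3 : ℝ) / 2) =
        2 / (√t * √(1 - t) * (1 + √(1 - t))) := by
  obtain ⟨h0, h1⟩ := ht
  have hpos : ∀ s ∈ Set.Icc 0 t, 0 < t * (1 - s) := fun s hs =>
    mul_pos h0 (sub_pos.2 (hs.2.trans_lt h1))
  have hderiv : ∀ s ∈ Set.Icc 0 t,
      HasDerivAt (fun s => 2 / t / √(t * (1 - s))) ((t * (1 - s)) ^ (-(3 : ℝ) / 2)) s := by
    intro s hs
    have hΔ := hpos s hs
    have hq : HasDerivAt (fun s => t * (1 - s)) (-t) s := by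
      refine (((hasDerivAt_id s).const_sub 1).const_mul t).congr_deriv ?_
      ring
    refine ((hasDerivAt_const s (2 / t)).div (hq.sqrt hΔ.ne')
      (Real.sqrt_ne_zero'.2 hΔ)).congr_deriv ?_
    rw [Real.rpow_neg_three_halves hΔ]
    have hr := Real.sqrt_pos.2 hΔ
    have hr2 := Real.sq_sqrt hΔ.le
    set r := √(t * (1 - s))
    rw [← hr2]
    field_simp
    ring
  obtain ⟨hint, heq⟩ := intervalIntegrable_and_integral_eq_sub_of_nonneg h0.le
    (fun s hs => (hderiv s hs).continuousAt.continuousWithinAt)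
    (fun s hs => hderiv s (Set.Ioo_subset_Icc_self hs))
    (fun s hs => Real.rpow_nonneg (hpos s (Set.Ioo_subset_Icc_self hs)).le _)
  refine ⟨hint, heq.trans ?_⟩
  rw [sub_zero, mul_one, Real.sqrt_mul h0.le]
  have ha := Real.sqrt_pos.2 h0
  have hb := Real.sqrt_pos.2 (sub_pos.2 h1)
  have ha2 := Real.sq_sqrt h0.le
  have hb2 := Real.sq_sqrt (sub_pos.2 h1).le
  set a := √t
  set b := √(1 - t)
  field_simp
  linear_combination -hb2

theorem outer_integral_symmetric :
    IntervalIntegrable (fun t : ℝ => 4 / ((4 - 3 * t) * √(t * (1 - t)))) volume 0 1 ∧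
      ∫ t in (0 : ℝ)..1, 4 / ((4 - 3 * t) * √(t * (1 - t))) = 2 * Real.pi := by
  have hcont : ContinuousOn (fun t : ℝ => 2 * Real.arccos ((4 - 5 * t) / (4 - 3 * t)))
      (Set.Icc 0 1) := by
    refine continuousOn_const.mul (Real.continuous_arccos.comp_continuousOn ?_)
    refine ContinuousOn.div (by fun_prop) (by fun_prop) fun t ht => ?_
    linarith [ht.2]
  have hderiv : ∀ t ∈ Set.Ioo (0 : ℝ) 1,
      HasDerivAt (fun t : ℝ => 2 * Real.arccos ((4 - 5 * t) / (4 - 3 * t)))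
        (4 / ((4 - 3 * t) * √(t * (1 - t)))) t := by
    rintro t ⟨h0, h1⟩
    have hA : 0 < 4 - 3 * t := by linarith
    have hA_ne : 4 - t * 3 ≠ 0 := by rw [mul_comm]; exact hA.ne'
    have hp : 0 < t * (1 - t) := mul_pos h0 (sub_pos.2 h1)
    have hlin : ∀ c : ℝ, HasDerivAt (fun t : ℝ => 4 - c * t) (-c) t := fun c => by
      refine (((hasDerivAt_id t).const_mul c).const_sub 4).congr_deriv ?_
      ring
    have hsq : 1 - ((4 - 5 * t) / (4 - 3 * t)) ^ 2 = (4 / (4 - 3 * t)) ^ 2 * (t * (1 - t)) := by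
      field_simp
      ring
    have hlow : (4 - 5 * t) / (4 - 3 * t) ≠ -1 := fun h => by
      rw [div_eq_iff hA.ne'] at h
      linarith
    have hupp : (4 - 5 * t) / (4 - 3 * t) ≠ 1 := fun h => by
      rw [div_eq_iff hA.ne'] at h
      linarith
    refine (((Real.hasDerivAt_arccos hlow hupp).comp t
      ((hlin 5).div (hlin 3) hA.ne')).const_mul 2).congr_deriv ?_
    rw [hsq, Real.sqrt_mul (sq_nonneg _), Real.sqrt_sq (by positivity)]
    have hr := Real.sqrt_pos.2 hp
    field_simp
    ring
  obtain ⟨hint, heq⟩ := intervalIntegrable_and_integral_eq_sub_of_nonneg zero_le_one hcont hderiv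
    fun t ht => div_nonneg (by norm_num)
      (mul_nonneg (by linarith [ht.2]) (Real.sqrt_nonneg _))
  refine ⟨hint, heq.trans ?_⟩
  norm_num

theorem outer_integral_product :
    IntervalIntegrable (fun t : ℝ => 2 / (√t * √(1 - t) * (1 + √(1 - t)))) volume 0 1 ∧
      ∫ t in (0 : ℝ)..1, 2 / (√t * √(1 - t) * (1 + √(1 - t))) = 4 := by
  have hden : ∀ t : ℝ, 0 < 1 + √(1 - t) := fun t => by positivity
  have hcont : ContinuousOn (fun t : ℝ => 4 * √t / (1 + √(1 - t))) (Set.Icc 0 1) :=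
    ContinuousOn.div (by fun_prop) (by fun_prop) fun t _ => (hden t).ne'
  have hderiv : ∀ t ∈ Set.Ioo (0 : ℝ) 1,
      HasDerivAt (fun t : ℝ => 4 * √t / (1 + √(1 - t)))
        (2 / (√t * √(1 - t) * (1 + √(1 - t)))) t := by
    rintro t ⟨h0, h1⟩
    have h1' := sub_pos.2 h1
    refine ((((hasDerivAt_id t).sqrt h0.ne').const_mul 4).div
      ((((hasDerivAt_id t).const_sub 1).sqrt h1'.ne').const_add 1) (hden t).ne').congr_deriv ?_
    have ha := Real.sqrt_pos.2 h0
    have hb := Real.sqrt_pos.2 h1'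
    have ha2 := Real.sq_sqrt h0.le
    have hb2 := Real.sq_sqrt h1'.le
    simp only [id]
    set a := √t
    set b := √(1 - t)
    field_simp
    linear_combination 4 * (ha2 + hb2)
  obtain ⟨hint, heq⟩ := intervalIntegrable_and_integral_eq_sub_of_nonneg zero_le_one hcont hderiv
    fun t _ => by positivity
  refine ⟨hint, heq.trans ?_⟩
  norm_num

/-- With `Δ(s,t) = t(1-t) + s(t-s)`, both double integrals over the
triangle `{(s,t) : 0 ≤ s ≤ t ≤ 1}` of `Δ(s,t)^{-3/2}` and of `(t(1-s))^{-3/2}` are finite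
(the integrands are integrable on the triangle), and
`∫∫ Δ(s,t)^{-3/2} ds dt ≥ (6/5) · ∫∫ (t(1-s))^{-3/2} ds dt`. -/
theorem statement19 :
    IntegrableOn
      (fun p : ℝ × ℝ => (p.2 * (1 - p.2) + p.1 * (p.2 - p.1)) ^ (-(3 : ℝ) / 2))
      {p : ℝ × ℝ | 0 ≤ p.1 ∧ p.1 ≤ p.2 ∧ p.2 ≤ 1} volume ∧
    IntegrableOn
      (fun p : ℝ × ℝ => (p.2 * (1 - p.1)) ^ (-(3 : ℝ) / 2))
      {p : ℝ × ℝ | 0 ≤ p.1 ∧ p.1 ≤ p.2 ∧ p.2 ≤ 1} volume ∧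
    (6 / 5 : ℝ) *
        ∫ p in {p : ℝ × ℝ | 0 ≤ p.1 ∧ p.1 ≤ p.2 ∧ p.2 ≤ 1},
          (p.2 * (1 - p.1)) ^ (-(3 : ℝ) / 2) ≤
      ∫ p in {p : ℝ × ℝ | 0 ≤ p.1 ∧ p.1 ≤ p.2 ∧ p.2 ≤ 1},
        (p.2 * (1 - p.2) + p.1 * (p.2 - p.1)) ^ (-(3 : ℝ) / 2) := by
  obtain ⟨hint_sym, heq_sym⟩ := integrableOn_triangle_and_integral_eq
    (f := fun p => (p.2 * (1 - p.2) + p.1 * (p.2 - p.1)) ^ (-(3 : ℝ) / 2)) (by fun_prop)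
    (fun p h0 h1 h2 => Real.rpow_nonneg (add_nonneg
      (mul_nonneg (h0.trans h1) (sub_nonneg.2 h2)) (mul_nonneg h0 (sub_nonneg.2 h1))) _)
    (fun _ ht => (inner_integral_symmetric ht).1) (fun _ ht => (inner_integral_symmetric ht).2)
    outer_integral_symmetric.1
  obtain ⟨hint_prod, heq_prod⟩ := integrableOn_triangle_and_integral_eq
    (f := fun p => (p.2 * (1 - p.1)) ^ (-(3 : ℝ) / 2)) (by fun_prop)
    (fun p h0 h1 h2 => Real.rpow_nonneg
      (mul_nonneg (h0.trans h1) (sub_nonneg.2 (h1.trans h2))) _)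
    (fun _ ht => (inner_integral_product ht).1) (fun _ ht => (inner_integral_product ht).2)
    outer_integral_product.1
  refine ⟨hint_sym, hint_prod, ?_⟩
  rw [heq_sym, heq_prod, outer_integral_symmetric.2, outer_integral_product.2]
  linarith [Real.pi_gt_three]
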